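/- arXiv:2310.06402 — 3 statements merged into one kernel-verified Lean document; each statement's English description precedes it below -/
import Mathlib

section
/- Assume ρ̂ = ρ + αλ_min − ζ̃_{L*−K} > 0, D_K is not the zero map, and ω_n = ω₀·η̄ⁿ for some ω₀ ≥ 0 and η̄ ∈ [0,1), with ‖K_n − K‖ ≤ ω_n for all n. Let ε ∈ (0, χ/2), let (γ_n) be a sequence in [ε, χ − ε], let z₀ ∈ H, and define for every n ∈ ℕ: u_n = D_{K_n} z_n, y_n = z_n − γ_n(C z_n + u_n), x_n = J_{γ_n A}(y_n), z_{n+1} = x_n + γ_n(u_n − D_{K_n} x_n). Then (z_n) converges linearly to the unique z* ∈ H with 0 ∈ A z* + C z* + D_K z*: there exist c ≥ 0 and r ∈ [0,1) with ‖z_n − z*‖ ≤ c·rⁿ for all n. -/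
open Filter Topology
open scoped RealInnerProductSpace Pointwise

noncomputable section

variable {H G : Type*}

/-- A set-valued operator `A` is `ρ`-monotone. -/
def IsMonotoneSV [NormedAddCommGroup H] [InnerProductSpace ℝ H]
    (ρ : ℝ) (A : H → Set H) : Prop :=
  ∀ x y u v, u ∈ A x → v ∈ A y → ρ * ‖x - y‖ ^ 2 ≤ ⟪x - y, u - v⟫

/-- `A` is maximally `ρ`-monotone: it is `ρ`-monotone and its graph is maximal, under
inclusion, among graphs of `ρ`-monotone operators. -/
def IsMaxMonotoneSV [NormedAddCommGroup H] [InnerProductSpace ℝ H]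
    (ρ : ℝ) (A : H → Set H) : Prop :=
  IsMonotoneSV ρ A ∧
    ∀ A' : H → Set H, IsMonotoneSV ρ A' → (∀ x, A x ⊆ A' x) → ∀ x, A' x = A x

/-- `C` is `β`-cocoercive. -/
def IsCocoercive [NormedAddCommGroup H] [InnerProductSpace ℝ H]
    (β : ℝ) (C : H → H) : Prop :=
  ∀ x y, β * ‖C x - C y‖ ^ 2 ≤ ⟪x - y, C x - C y⟫

/-- `k` is a Lipschitz bound for `f`. -/
def IsLipBound {E F : Type*} [NormedAddCommGroup E] [NormedAddCommGroup F]
    (k : ℝ) (f : E → F) : Prop :=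
  ∀ x y, ‖f x - f y‖ ≤ k * ‖x - y‖

/-- `k` is the (smallest) Lipschitz constant of `f`. -/
def IsLipConst {E F : Type*} [NormedAddCommGroup E] [NormedAddCommGroup F]
    (k : ℝ) (f : E → F) : Prop :=
  IsLipBound k f ∧ ∀ k', IsLipBound k' f → k ≤ k'

/-- A single-valued map `B` is monotone. -/
def IsMonotoneMap [NormedAddCommGroup G] [InnerProductSpace ℝ G]
    (B : G → G) : Prop :=
  ∀ x y, (0:ℝ) ≤ ⟪x - y, B x - B y⟫

/-- The operator `D_M : x ↦ α M (L x - c) + M (B (L x))`. -/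
def Dop [NormedAddCommGroup H] [InnerProductSpace ℝ H]
    [NormedAddCommGroup G] [InnerProductSpace ℝ G]
    (α : ℝ) (L : H →L[ℝ] G) (c : G) (B : G → G) (M : G →L[ℝ] H) : H → H :=
  fun x => α • M (L x - c) + M (B (L x))

/-- `λ_min = inf {⟪x, K (L x)⟫ : ‖x‖ = 1}`. -/
def lambdaMin [NormedAddCommGroup H] [InnerProductSpace ℝ H]
    [NormedAddCommGroup G] [InnerProductSpace ℝ G]
    (L : H →L[ℝ] G) (K : G →L[ℝ] H) : ℝ :=
  sInf {r : ℝ | ∃ x : H, ‖x‖ = 1 ∧ r = ⟪x, K (L x)⟫}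

/-- The step-size bound `χ`. -/
def chiConst (β ρ κ : ℝ) : ℝ :=
  if 0 ≤ ρ then 4 * β / (1 + Real.sqrt (1 + 16 * β ^ 2 * κ ^ 2))
  else min (4 * β / (1 + Real.sqrt (1 + 16 * β ^ 2 * κ ^ 2))) (-1 / ρ)

/-- A self-map of a complete normed space with Lipschitz bound `k < 1` has a fixed point. -/
lemma exists_fixed_of_isLipBound {E : Type*} [NormedAddCommGroup E] [CompleteSpace E]
    {f : E → E} {k : ℝ} (hk0 : 0 ≤ k) (hk1 : k < 1) (hf : IsLipBound k f) :
    ∃ x, f x = x := by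
  have hc : ContractingWith ⟨k, hk0⟩ f := by
    refine ⟨by exact_mod_cast hk1, LipschitzWith.of_dist_le_mul fun x y => ?_⟩
    rw [dist_eq_norm, dist_eq_norm]
    exact hf x y
  exact ⟨_, hc.fixedPoint_isFixedPt⟩

lemma IsCocoercive.isLipBound [NormedAddCommGroup H] [InnerProductSpace ℝ H]
    {β : ℝ} {C : H → H} (hβ : 0 < β) (hC : IsCocoercive β C) : IsLipBound β⁻¹ C := by
  intro x y
  have h1 := (hC x y).trans (real_inner_le_norm _ _)
  rcases (norm_nonneg (C x - C y)).eq_or_lt with h0 | h0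
  · rw [← h0]; positivity
  · rw [inv_mul_eq_div, le_div_iff₀ hβ]
    nlinarith

lemma norm_le_div_of_mul_sq_le_inner [NormedAddCommGroup H] [InnerProductSpace ℝ H]
    {k : ℝ} (hk : 0 < k) {p q : H} (h : k * ‖p‖ ^ 2 ≤ ⟪p, q⟫) : ‖p‖ ≤ k⁻¹ * ‖q‖ := by
  have h1 := h.trans (real_inner_le_norm _ _)
  rcases (norm_nonneg p).eq_or_lt with h0 | h0
  · rw [← h0]; positivity
  · rw [inv_mul_eq_div, le_div_iff₀ hk]
    nlinarith

/-- If `A` is `ρ`-monotone with everywhere defined resolvents for small parameters, `F` is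
Lipschitzian and `A + F` is strongly monotone, then `A + F` has a zero. -/
lemma exists_zero_of_strongly_monotone_add [NormedAddCommGroup H] [InnerProductSpace ℝ H]
    [CompleteSpace H] {ρ χ l m : ℝ} {A : H → Set H} {F : H → H} (hA : IsMonotoneSV ρ A)
    (hχ : 0 < χ) (hres : ∀ t, 0 < t → t < χ → ∀ x, ∃ y, x - y ∈ t • A y)
    (hl : 0 ≤ l) (hF : IsLipBound l F) (hm : 0 < m)
    (hAF : IsMonotoneSV m (fun x => (fun u => u + F x) '' A x)) :
    ∃ z, -F z ∈ A z := by
  obtain ⟨t, ht0, htχ, ht⟩ : ∃ t : ℝ, 0 < t ∧ t < χ ∧ t * (l + |ρ|) < 1 := by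
    have hd : 0 < 2 * (l + |ρ| + 1) := by positivity
    refine ⟨min (χ / 2) (1 / (2 * (l + |ρ| + 1))), by positivity,
      (min_le_left _ _).trans_lt (by linarith), ?_⟩
    refine (mul_le_mul_of_nonneg_right (min_le_right _ _) (by positivity)).trans_lt ?_
    rw [one_div_mul_eq_div, div_lt_one hd]
    have := abs_nonneg ρ
    linarith
  have hρt : t * l < 1 + t * ρ := by
    have := neg_abs_le ρ
    nlinarith
  have hpos : 0 < 1 + t * ρ := (by positivity : 0 ≤ t * l).trans_lt hρt
  choose R a ha hR using fun x => hres t ht0 htχ x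
  have hR' : ∀ x, t • a x = x - R x := hR
  have hRlip : IsLipBound (1 + t * ρ)⁻¹ R := by
    intro x y
    apply norm_le_div_of_mul_sq_le_inner hpos
    have h := mul_le_mul_of_nonneg_left (hA _ _ _ _ (ha x) (ha y)) ht0.le
    rw [← real_inner_smul_right, smul_sub, hR', hR', sub_sub_sub_comm, inner_sub_right,
      real_inner_self_eq_norm_sq] at h
    linarith
  have hS : ∀ y, ∃ x, R (y - t • F x) = x := by
    intro y
    refine exists_fixed_of_isLipBound (k := (1 + t * ρ)⁻¹ * (t * l)) (by positivity) ?_ ?_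
    · rw [inv_mul_eq_div, div_lt_one hpos]; exact hρt
    · intro u v
      refine (hRlip _ _).trans ?_
      rw [mul_assoc]
      gcongr
      rw [sub_sub_sub_cancel_left, ← smul_sub, norm_smul, Real.norm_of_nonneg ht0.le, norm_sub_rev,
        mul_assoc]
      gcongr
      exact hF u v
  choose S hS using hS
  have hSa : ∀ y, ∃ b ∈ A (S y), t • (b + F (S y)) = y - S y := by
    intro y
    refine ⟨a (y - t • F (S y)), ?_, ?_⟩
    · have := ha (y - t • F (S y))
      rwa [hS] at this
    · rw [smul_add, hR', hS]; abel
  choose b hb hbS using hSa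
  have hpos' : 0 < 1 + t * m := by positivity
  have hSlip : IsLipBound (1 + t * m)⁻¹ S := by
    intro x y
    apply norm_le_div_of_mul_sq_le_inner hpos'
    have h := mul_le_mul_of_nonneg_left
      (hAF _ _ _ _ (Set.mem_image_of_mem _ (hb x)) (Set.mem_image_of_mem _ (hb y))) ht0.le
    rw [← real_inner_smul_right, smul_sub, hbS, hbS, sub_sub_sub_comm, inner_sub_right,
      real_inner_self_eq_norm_sq] at h
    linarith
  obtain ⟨z, hz⟩ := exists_fixed_of_isLipBound (by positivity)
    (inv_lt_one_of_one_lt₀ (by nlinarith)) hSlip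
  refine ⟨z, ?_⟩
  have h1 := hbS z
  rw [hz, sub_self, smul_eq_zero_iff_right ht0.ne'] at h1
  have h2 := hb z
  rwa [hz, eq_neg_of_add_eq_zero_left h1] at h2

/-- A nonnegative sequence that eventually contracts up to a geometric error decays
geometrically. -/
lemma exists_geometric_bound {e : ℕ → ℝ} (he : ∀ n, 0 ≤ e n) {q η M : ℝ} (hq : q < 1)
    (hη0 : 0 ≤ η) (hη1 : η < 1) (hM : 0 ≤ M)
    (h : ∀ᶠ n in atTop, e (n + 1) ≤ q * e n + M * η ^ n) :
    ∃ c r : ℝ, 0 ≤ c ∧ 0 ≤ r ∧ r < 1 ∧ ∀ n, e n ≤ c * r ^ n := by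
  obtain ⟨N, hN⟩ := eventually_atTop.1 h
  obtain ⟨r, hr, hr1⟩ := exists_between (max_lt (max_lt hq hη1) one_pos)
  simp only [max_lt_iff] at hr
  obtain ⟨⟨hqr, hηr⟩, hr0⟩ := hr
  have hS : ∀ k, 0 ≤ e k / r ^ k := fun k => div_nonneg (he k) (by positivity)
  have hp : 0 < r - max q 0 := sub_pos.2 (max_lt hqr hr0)
  set c := M / (r - max q 0) + ∑ k ∈ Finset.range (N + 1), e k / r ^ k with hc
  have hc0 : 0 ≤ c := add_nonneg (by positivity) (Finset.sum_nonneg fun k _ => hS k)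
  have hlow : ∀ n ≤ N, e n ≤ c * r ^ n := by
    intro n hn
    rw [← div_le_iff₀ (by positivity)]
    have h1 := Finset.single_le_sum (f := fun k => e k / r ^ k) (fun k _ => hS k)
      (Finset.mem_range.2 (Nat.lt_succ_of_le hn))
    have h2 : 0 ≤ M / (r - max q 0) := by positivity
    linarith
  have hMc : M ≤ c * (r - max q 0) := by
    rw [← div_le_iff₀ hp, hc]
    exact le_add_of_nonneg_right (Finset.sum_nonneg fun k _ => hS k)
  refine ⟨c, r, hc0, hr0.le, hr1, fun n => ?_⟩
  rcases le_total n N with hn | hn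
  · exact hlow n hn
  induction n, hn using Nat.le_induction with
  | base => exact hlow N le_rfl
  | succ n hn ih =>
    calc e (n + 1) ≤ q * e n + M * η ^ n := hN n hn
      _ ≤ max q 0 * (c * r ^ n) + c * (r - max q 0) * r ^ n := by
        refine add_le_add ((mul_le_mul_of_nonneg_right (le_max_left q 0) (he n)).trans
          (mul_le_mul_of_nonneg_left ih (le_max_right q 0))) ?_
        gcongr
      _ = c * r ^ (n + 1) := by ring

/-- One step of the perturbed forward-backward-forward iteration. -/
lemma forward_backward_forward_step [NormedAddCommGroup H] [InnerProductSpace ℝ H]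
    {z x zs cz cs dz dx Dx Ds : H} {γ β ρ μ l δ : ℝ} (hβ : 0 < β) (hγ : 0 < γ)
    (hmono : γ * (ρ * ‖x - zs‖ ^ 2) ≤ ⟪x - zs, z - x - γ • (cz - cs) - γ • (dz - Ds)⟫)
    (hD : μ * ‖x - zs‖ ^ 2 ≤ ⟪x - zs, Dx - Ds⟫)
    (hC : β * ‖cz - cs‖ ^ 2 ≤ ⟪z - zs, cz - cs⟫)
    (herr : ‖dx - Dx‖ ≤ δ) (hlip : ‖dz - dx‖ ≤ l * ‖z - x‖) :
    ‖x + γ • (dz - dx) - zs‖ ^ 2 ≤ ‖z - zs‖ ^ 2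
      - (1 - γ ^ 2 * l ^ 2 - γ / (2 * β)) * ‖z - x‖ ^ 2
      - 2 * γ * (ρ + μ) * ‖x - zs‖ ^ 2 + 2 * γ * (δ * ‖x - zs‖) := by
  have e1 : x + γ • (dz - dx) - zs = (x - zs) + γ • (dz - dx) := by abel
  have e2 : z - zs = (x - zs) + (z - x) := by abel
  have e3 : dz - Ds = (dz - dx) + (dx - Dx) + (Dx - Ds) := by abel
  rw [e2] at hC ⊢
  rw [e1]
  rw [e3] at hmono
  generalize x - zs = p at *
  generalize z - x = q at *
  generalize cz - cs = c at *
  generalize dz - dx = d at *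
  generalize Dx - Ds = D at *
  generalize dx - Dx = E at *
  rw [norm_add_sq_real, norm_add_sq_real, norm_smul, Real.norm_of_nonneg hγ.le]
  simp only [inner_sub_right, inner_add_right, inner_add_left, real_inner_smul_right,
    smul_add] at hmono hC ⊢
  have hqc := (abs_le.1 (abs_real_inner_le_norm q c)).2
  have hpE := (abs_le.1 (abs_real_inner_le_norm p E)).1
  have hpE' : ‖p‖ * ‖E‖ ≤ δ * ‖p‖ := by
    rw [mul_comm]; gcongr
  have hd : ‖d‖ ^ 2 ≤ l ^ 2 * ‖q‖ ^ 2 := by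
    rw [← mul_pow]; gcongr
  have hpc : -(‖q‖ ^ 2 / (4 * β)) ≤ ⟪p, c⟫ := by
    have h0 : 0 ≤ (2 * β * ‖c‖ - ‖q‖) ^ 2 / (4 * β) := by positivity
    have h1 : (2 * β * ‖c‖ - ‖q‖) ^ 2 / (4 * β)
        = β * ‖c‖ ^ 2 - ‖q‖ * ‖c‖ + ‖q‖ ^ 2 / (4 * β) := by
      field_simp; ring
    linarith
  have g1 := mul_le_mul_of_nonneg_left hpc hγ.le
  have g2 : γ * -(δ * ‖p‖) ≤ γ * ⟪p, E⟫ := mul_le_mul_of_nonneg_left (by linarith) hγ.le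
  have g3 := mul_le_mul_of_nonneg_left hD hγ.le
  have g4 := mul_le_mul_of_nonneg_left hd (sq_nonneg γ)
  have g5 : γ / (2 * β) * ‖q‖ ^ 2 = 2 * (γ * (‖q‖ ^ 2 / (4 * β))) := by
    field_simp; ring
  nlinarith

lemma lambdaMin_mul_sq_le [NormedAddCommGroup H] [InnerProductSpace ℝ H]
    [NormedAddCommGroup G] [InnerProductSpace ℝ G] (L : H →L[ℝ] G) (K : G →L[ℝ] H) (x : H) :
    lambdaMin L K * ‖x‖ ^ 2 ≤ ⟪x, K (L x)⟫ := by
  rcases eq_or_ne x 0 with rfl | hx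
  · simp
  have hn : 0 < ‖x‖ := norm_pos_iff.2 hx
  have hb : BddBelow {r : ℝ | ∃ x : H, ‖x‖ = 1 ∧ r = ⟪x, K (L x)⟫} := by
    refine ⟨-‖K.comp L‖, ?_⟩
    rintro _ ⟨y, hy, rfl⟩
    have h1 := (abs_le.1 (abs_real_inner_le_norm y (K (L y)))).1
    have h2 := (K.comp L).le_opNorm y
    simp only [hy, mul_one, one_mul, ContinuousLinearMap.comp_apply] at h1 h2
    linarith
  have h := csInf_le hb ⟨‖x‖⁻¹ • x, by rw [norm_smul, norm_inv, norm_norm, inv_mul_cancel₀ hn.ne'],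
    rfl⟩
  rw [map_smul, map_smul, real_inner_smul_left, real_inner_smul_right, ← mul_assoc, ← sq,
    inv_pow, inv_mul_eq_div, le_div_iff₀ (by positivity)] at h
  exact h

lemma Dop_sub_Dop [NormedAddCommGroup H] [InnerProductSpace ℝ H]
    [NormedAddCommGroup G] [InnerProductSpace ℝ G]
    (α : ℝ) (L : H →L[ℝ] G) (c : G) (B : G → G) (M : G →L[ℝ] H) (x y : H) :
    Dop α L c B M x - Dop α L c B M y = M (α • L (x - y) + (B (L x) - B (L y))) := by
  simp only [Dop, map_sub, map_add, map_smul, smul_sub]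
  abel

lemma Dop_strongly_monotone [NormedAddCommGroup H] [InnerProductSpace ℝ H] [CompleteSpace H]
    [NormedAddCommGroup G] [InnerProductSpace ℝ G] [CompleteSpace G]
    {α ζt : ℝ} (hα : 0 ≤ α) {L : H →L[ℝ] G} (c : G) {B : G → G} {K : G →L[ℝ] H}
    (hB : IsMonotoneMap B)
    (hζt : IsLipBound ζt (fun x : H => (ContinuousLinearMap.adjoint L - K) (B (L x)))) (x y : H) :
    (α * lambdaMin L K - ζt) * ‖x - y‖ ^ 2 ≤ ⟪x - y, Dop α L c B K x - Dop α L c B K y⟫ := by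
  have h1 := mul_le_mul_of_nonneg_left (lambdaMin_mul_sq_le L K (x - y)) hα
  have h2 := hB (L x) (L y)
  have h3 := (abs_le.1 (abs_real_inner_le_norm (x - y)
    ((ContinuousLinearMap.adjoint L - K) (B (L x)) -
      (ContinuousLinearMap.adjoint L - K) (B (L y))))).2
  have h4 := mul_le_mul_of_nonneg_left (hζt x y) (norm_nonneg (x - y))
  have h5 := h3.trans h4
  rw [← map_sub, _root_.sub_apply, inner_sub_right,
    ContinuousLinearMap.adjoint_inner_right, map_sub] at h5
  rw [Dop_sub_Dop, map_add, inner_add_right, map_smul, real_inner_smul_right]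
  simp only [map_sub] at *
  linarith

lemma chiConst_le (β ρ κ : ℝ) :
    chiConst β ρ κ ≤ 4 * β / (1 + Real.sqrt (1 + 16 * β ^ 2 * κ ^ 2)) := by
  unfold chiConst
  split_ifs
  exacts [le_rfl, min_le_left _ _]

lemma step_coefficient_pos {β ρ κ g : ℝ} (hβ : 0 < β) (hg : 0 < g) (h : g < chiConst β ρ κ) :
    0 < 1 - g ^ 2 * κ ^ 2 - g / (2 * β) := by
  have h1 := h.trans_le (chiConst_le β ρ κ)
  set s := Real.sqrt (1 + 16 * β ^ 2 * κ ^ 2) with hs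
  have hs0 : 0 ≤ s := Real.sqrt_nonneg _
  have hs2 : s ^ 2 = 1 + 16 * β ^ 2 * κ ^ 2 := Real.sq_sqrt (by positivity)
  rw [lt_div_iff₀ (by positivity)] at h1
  have h2 : (g * s) ^ 2 < (4 * β - g) ^ 2 := by
    have : 0 ≤ g * s := by positivity
    gcongr
    linarith
  rw [mul_pow, hs2] at h2
  have h3 : 1 - g ^ 2 * κ ^ 2 - g / (2 * β)
      = ((4 * β - g) ^ 2 - g ^ 2 * (1 + 16 * β ^ 2 * κ ^ 2)) / (16 * β ^ 2) := by
    field_simp; ring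
  rw [h3]
  have : 0 < (4 * β - g) ^ 2 - g ^ 2 * (1 + 16 * β ^ 2 * κ ^ 2) := by linarith
  positivity

lemma norm_smul_add_sub_le [NormedAddCommGroup H] [InnerProductSpace ℝ H]
    [NormedAddCommGroup G] [InnerProductSpace ℝ G] {α ζ : ℝ} (hα : 0 ≤ α) (hζ : 0 ≤ ζ)
    (L : H →L[ℝ] G) {B : G → G} (hB : IsLipBound ζ B) (p q : H) :
    ‖α • L (p - q) + (B (L p) - B (L q))‖ ≤ (α + ζ) * ‖L‖ * ‖p - q‖ := by
  have h1 := hB (L p) (L q)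
  rw [← map_sub] at h1
  have h2 := L.le_opNorm (p - q)
  calc _ ≤ ‖α • L (p - q)‖ + ‖B (L p) - B (L q)‖ := norm_add_le _ _
    _ ≤ α * ‖L (p - q)‖ + ζ * ‖L (p - q)‖ := by
      rw [norm_smul, Real.norm_of_nonneg hα]; linarith
    _ = (α + ζ) * ‖L (p - q)‖ := by ring
    _ ≤ (α + ζ) * (‖L‖ * ‖p - q‖) := by gcongr
    _ = (α + ζ) * ‖L‖ * ‖p - q‖ := by ring

lemma contraction_of_step_estimate {E t d s w γ ε g ρ m k a b : ℝ} (hw : 0 ≤ w) (hγ : 0 < γ)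
    (hεγ : ε ≤ γ) (hγg : γ ≤ g) (hρ : 0 ≤ ρ) (hm : 0 ≤ m) (hmk : 2 * m ≤ k)
    (hmε : 2 * m ≤ ε * ρ) (hwa : w * (2 * a + 1) ≤ ρ) (htri : t ≤ d + s) (ht : 0 ≤ t)
    (h : E ≤ t ^ 2 - k * d ^ 2 - 2 * γ * ρ * s ^ 2 + 2 * γ * (w * (a * s + b) * s)) :
    E ≤ (1 - m) * t ^ 2 + g * (w * b ^ 2) := by
  have h1 : t ^ 2 ≤ 2 * d ^ 2 + 2 * s ^ 2 := by
    nlinarith [sq_nonneg (d - s)]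
  have h2 : 2 * (w * (a * s + b) * s) ≤ w * (2 * a + 1) * s ^ 2 + w * b ^ 2 := by
    nlinarith [mul_nonneg hw (sq_nonneg (s - b))]
  have p1 := mul_le_mul_of_nonneg_right hmk (sq_nonneg d)
  have p2 := mul_le_mul_of_nonneg_left h2 hγ.le
  have p3 := mul_le_mul_of_nonneg_left (mul_le_mul_of_nonneg_right hwa (sq_nonneg s)) hγ.le
  have p4 := mul_le_mul_of_nonneg_right
    (hmε.trans (mul_le_mul_of_nonneg_right hεγ hρ)) (sq_nonneg s)
  have p5 : γ * (w * b ^ 2) ≤ g * (w * b ^ 2) := by gcongr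
  have p6 := mul_le_mul_of_nonneg_left h1 hm
  linarith

set_option maxHeartbeats 400000 in
theorem statement13 {H G : Type*} [NormedAddCommGroup H] [InnerProductSpace ℝ H] [CompleteSpace H]
    [NormedAddCommGroup G] [InnerProductSpace ℝ G] [CompleteSpace G]
    (ρ β ζ α : ℝ) (A : H → Set H) (C : H → H) (B : G → G)
    (L : H →L[ℝ] G) (K : G →L[ℝ] H) (c : G)
    (hA : IsMaxMonotoneSV ρ A)
    (hβ : 0 < β) (hC : IsCocoercive β C)
    (hζ : 0 < ζ) (hBmono : IsMonotoneMap B) (hBlip : IsLipBound ζ B)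
    (hα : 0 ≤ α)
    (ζt : ℝ)
    (hζt : IsLipConst ζt (fun x : H => (ContinuousLinearMap.adjoint L - K) (B (L x))))
    (κ : ℝ) (hκ : IsLipConst κ (fun x : H => K (α • L x + B (L x))))
    (hρhat : 0 < (ρ + α * lambdaMin L K - ζt))
    (hDK : ∃ x : H, Dop α L c B K x ≠ 0)
    (Kn : ℕ → G →L[ℝ] H) (ω0 etab : ℝ) (hω0 : 0 ≤ ω0)
    (hetab0 : 0 ≤ etab) (hetab1 : etab < 1)
    (hKn : ∀ n, ‖Kn n - K‖ ≤ ω0 * etab ^ n)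
    (ε : ℝ) (hε0 : 0 < ε) (hεχ : ε < chiConst β ρ κ / 2)
    (γ : ℕ → ℝ) (hγ1 : ∀ n, ε ≤ γ n) (hγ2 : ∀ n, γ n ≤ chiConst β ρ κ - ε)
    (J : ℝ → H → H)
    (hJ : ∀ γ' : ℝ, 0 < γ' → γ' < chiConst β ρ κ → ∀ x y : H, J γ' x = y ↔ x - y ∈ γ' • A y)
    (z x : ℕ → H)
    (hx : ∀ n, x n = J (γ n) (z n - γ n • (C (z n) + Dop α L c B (Kn n) (z n))))
    (hzrec : ∀ n, z (n + 1) =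
      x n + γ n • (Dop α L c B (Kn n) (z n) - Dop α L c B (Kn n) (x n))) :
    ∃ zs : H, ((0:H) ∈ (fun u => u + C zs + Dop α L c B K zs) '' A zs) ∧
      (∀ z' : H, ((0:H) ∈ (fun u => u + C z' + Dop α L c B K z') '' A z') → z' = zs) ∧
      ∃ cc r : ℝ, 0 ≤ cc ∧ 0 ≤ r ∧ r < 1 ∧ ∀ n, ‖z n - zs‖ ≤ cc * r ^ n := by
  have hχ : 0 < chiConst β ρ κ := by linarith
  obtain ⟨v, hv⟩ := hDK
  have hκ0 : 0 ≤ κ := by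
    have h := (norm_nonneg _).trans (hκ.1 (Dop α L c B K v) 0)
    rw [sub_zero] at h
    exact nonneg_of_mul_nonneg_left h (norm_pos_iff.2 hv)
  have hDmono := Dop_strongly_monotone hα c hBmono hζt.1
  have hDlip : IsLipBound κ (Dop α L c B K) := by
    intro p q
    have h := hκ.1 p q
    have e : K (α • L p + B (L p)) - K (α • L q + B (L q))
        = Dop α L c B K p - Dop α L c B K q := by
      rw [Dop_sub_Dop, ← map_sub, map_sub L, smul_sub]
      congr 1
      abel
    rwa [e] at h
  have hsum : IsMonotoneSV (ρ + α * lambdaMin L K - ζt)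
      (fun p => (fun u => u + (C p + Dop α L c B K p)) '' A p) := by
    rintro p q _ _ ⟨u, hu, rfl⟩ ⟨w, hw, rfl⟩
    have h1 := hA.1 p q u w hu hw
    have h2 := hDmono p q
    have h3 := (by positivity : (0 : ℝ) ≤ β * ‖C p - C q‖ ^ 2).trans (hC p q)
    have e : u + (C p + Dop α L c B K p) - (w + (C q + Dop α L c B K q))
        = (u - w) + (C p - C q) + (Dop α L c B K p - Dop α L c B K q) := by abel
    simp only
    rw [e, inner_add_right, inner_add_right]
    linarith
  obtain ⟨zs, hzs⟩ := exists_zero_of_strongly_monotone_add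
    (F := fun p => C p + Dop α L c B K p) (l := β⁻¹ + κ) hA.1 hχ
    (fun t ht0 htχ p => ⟨J t p, (hJ t ht0 htχ p _).1 rfl⟩) (by positivity)
    (fun p q => by
      rw [add_sub_add_comm, add_mul]
      exact (norm_add_le _ _).trans (add_le_add (hC.isLipBound hβ p q) (hDlip p q)))
    hρhat hsum
  refine ⟨zs, ⟨_, hzs, by simp only; abel⟩, ?_, ?_⟩
  · rintro z' ⟨u, hu, hu0⟩
    have h := hsum z' zs _ _ ⟨u, hu, rfl⟩ ⟨_, hzs, rfl⟩
    simp only at h hu0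
    rw [← add_assoc, hu0, neg_add_cancel, sub_zero, inner_zero_right] at h
    have h0 : ‖z' - zs‖ ^ 2 ≤ 0 := by
      by_contra! hlt
      exact absurd h (not_le.2 (mul_pos hρhat hlt))
    exact sub_eq_zero.1 (norm_eq_zero.1 (pow_eq_zero_iff two_ne_zero |>.1
      (le_antisymm h0 (sq_nonneg _))))
  set g := chiConst β ρ κ - ε with hg
  have hg0 : 0 < g := by linarith
  have hδ := step_coefficient_pos (ρ := ρ) hβ hg0 (by linarith : g < chiConst β ρ κ)
  set δ := 1 - g ^ 2 * κ ^ 2 - g / (2 * β) with hδdef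
  set ρh := ρ + α * lambdaMin L K - ζt with hρh
  set w : ℕ → ℝ := fun n => ω0 * etab ^ n with hw
  have hw0 : ∀ n, 0 ≤ w n := fun n => by positivity
  have hwlim : Tendsto w atTop (𝓝 0) := by
    simpa using (tendsto_pow_atTop_nhds_zero_of_lt_one hetab0 hetab1).const_mul ω0
  set a := (α + ζ) * ‖L‖ with ha
  have ha0 : 0 ≤ a := by positivity
  set b := ‖α • (L zs - c) + B (L zs)‖ with hb
  have hpert := norm_smul_add_sub_le hα hζ.le L hBlip
  have hlipn : ∀ n p q, ‖Dop α L c B (Kn n) p - Dop α L c B (Kn n) q‖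
      ≤ (κ + w n * a) * ‖p - q‖ := by
    intro n p q
    have e : Dop α L c B (Kn n) p - Dop α L c B (Kn n) q
        = (Dop α L c B K p - Dop α L c B K q)
          + (Kn n - K) (α • L (p - q) + (B (L p) - B (L q))) := by
      rw [Dop_sub_Dop, Dop_sub_Dop, _root_.sub_apply]; abel
    rw [e, add_mul, mul_assoc]
    exact (norm_add_le _ _).trans (add_le_add (hDlip p q)
      ((Kn n - K).le_of_opNorm_le_of_le (hKn n) (hpert p q)))
  have herr : ∀ n p, ‖Dop α L c B (Kn n) p - Dop α L c B K p‖
      ≤ w n * (a * ‖p - zs‖ + b) := by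
    intro n p
    have e : Dop α L c B (Kn n) p - Dop α L c B K p
        = (Kn n - K) ((α • L (p - zs) + (B (L p) - B (L zs)))
          + (α • (L zs - c) + B (L zs))) := by
      have e' : (α • L (p - zs) + (B (L p) - B (L zs))) + (α • (L zs - c) + B (L zs))
          = α • (L p - c) + B (L p) := by
        rw [map_sub, smul_sub, smul_sub, smul_sub]; abel
      rw [e', _root_.sub_apply]
      simp only [Dop, map_add, map_smul]
    rw [e]
    exact (Kn n - K).le_of_opNorm_le_of_le (hKn n)
      ((norm_add_le _ _).trans (add_le_add_left (hpert p zs) _))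
  have hγ0 : ∀ n, 0 < γ n := fun n => hε0.trans_le (hγ1 n)
  have hstep : ∀ n, ‖z (n + 1) - zs‖ ^ 2 ≤ ‖z n - zs‖ ^ 2
      - (1 - γ n ^ 2 * (κ + w n * a) ^ 2 - γ n / (2 * β)) * ‖z n - x n‖ ^ 2
      - 2 * γ n * (ρ + (α * lambdaMin L K - ζt)) * ‖x n - zs‖ ^ 2
      + 2 * γ n * (w n * (a * ‖x n - zs‖ + b) * ‖x n - zs‖) := by
    intro n
    rw [hzrec n]
    refine forward_backward_forward_step (cz := C (z n)) (cs := C zs)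
      (Ds := Dop α L c B K zs) hβ (hγ0 n) ?_ (hDmono (x n) zs) (hC _ _) (herr n _) (hlipn n _ _)
    obtain ⟨u, hu, hux⟩ := (hJ (γ n) (hγ0 n) (by linarith [hγ2 n]) _ _).1 (hx n).symm
    have hux' : γ n • u = z n - γ n • (C (z n) + Dop α L c B (Kn n) (z n)) - x n := hux
    have h := mul_le_mul_of_nonneg_left (hA.1 _ _ _ _ hu hzs) (hγ0 n).le
    rw [← real_inner_smul_right, smul_sub, hux'] at h
    refine h.trans_eq ?_
    congr 1
    simp only [smul_sub, smul_add, smul_neg]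
    abel
  have hev1 : ∀ᶠ n in atTop, δ / 2 < 1 - g ^ 2 * (κ + w n * a) ^ 2 - g / (2 * β) := by
    have ht : Tendsto (fun n => 1 - g ^ 2 * (κ + w n * a) ^ 2 - g / (2 * β)) atTop (𝓝 δ) := by
      have := ((((hwlim.mul_const a).const_add κ).pow 2).const_mul (g ^ 2)).const_sub 1
        |>.sub_const (g / (2 * β))
      simpa [hδdef] using this
    exact ht.eventually_const_lt (by linarith)
  have hev2 : ∀ᶠ n in atTop, w n * (2 * a + 1) < ρh := by
    have ht : Tendsto (fun n => w n * (2 * a + 1)) atTop (𝓝 0) := by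
      simpa using hwlim.mul_const (2 * a + 1)
    exact ht.eventually_lt_const hρhat
  set m := min (δ / 2) (ε * ρh) / 2 with hm
  have hm0 : 0 < m := by positivity
  have hm1 : 2 * m ≤ δ / 2 := by
    have := min_le_left (δ / 2) (ε * ρh); linarith
  have hm2 : 2 * m ≤ ε * ρh := by
    have := min_le_right (δ / 2) (ε * ρh); linarith
  obtain ⟨cc, r, hcc, hr0, hr1, hbound⟩ := exists_geometric_bound
    (e := fun n => ‖z n - zs‖ ^ 2) (q := 1 - m) (η := etab) (M := g * b ^ 2 * ω0)
    (fun n => sq_nonneg _) (by linarith) hetab0 hetab1 (by positivity) (by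
      filter_upwards [hev1, hev2] with n h1 h2
      have hco : δ / 2 ≤ 1 - γ n ^ 2 * (κ + w n * a) ^ 2 - γ n / (2 * β) := by
        have hγn := hγ0 n
        have hγg : γ n ≤ g := hγ2 n
        have k1 : γ n ^ 2 * (κ + w n * a) ^ 2 ≤ g ^ 2 * (κ + w n * a) ^ 2 := by gcongr
        have k2 : γ n / (2 * β) ≤ g / (2 * β) := by gcongr
        linarith
      have e1 : ρ + (α * lambdaMin L K - ζt) = ρh := by rw [hρh]; ring
      have hs := hstep n
      rw [e1] at hs
      refine (contraction_of_step_estimate (hw0 n) (hγ0 n) (hγ1 n) (hγ2 n) hρhat.le hm0.le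
        (hm1.trans hco) hm2 h2.le
        (norm_sub_le_norm_sub_add_norm_sub (z n) (x n) zs) (norm_nonneg _) hs).trans_eq ?_
      rw [hw]; ring)
  refine ⟨√cc, √r, Real.sqrt_nonneg _, Real.sqrt_nonneg _, ?_, fun n => ?_⟩
  · rw [Real.sqrt_lt' one_pos]; simpa using hr1
  · refine abs_le_of_sq_le_sq' ?_ (by positivity) |>.2
    rw [mul_pow, ← pow_mul, mul_comm n 2, pow_mul, Real.sq_sqrt hcc, Real.sq_sqrt hr0]
    exact hbound n
end
end

section
/- Assume ρ̂ = ρ + αλ_min − ζ̃_{L*−K} ≥ 0 and let γ ∈ Γ. Then zer(A + C + D_K) = J_{γC}(Fix V^γ), i.e. {x ∈ H : 0 ∈ A x + C x + D_K x} = {J_{γC}(z) : z ∈ H, V^γ z = z}. -/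
open Filter Topology
open scoped RealInnerProductSpace Pointwise

noncomputable section

variable {H G : Type*}

/-- If `f` has Lipschitz bound `κ` and `γ * κ < 1` with `0 < γ`, then `Id - γ f` is injective. -/
theorem IsLipBound.injective_sub_smul {E : Type*} [NormedAddCommGroup E] [NormedSpace ℝ E]
    {κ γ : ℝ} {f : E → E} (hf : IsLipBound κ f) (hγ : 0 < γ) (hκ : γ * κ < 1) :
    Function.Injective fun x => x - γ • f x := by
  intro x y hxy
  have hsub : x - y = γ • (f x - f y) := by
    have h : x - γ • f x = y - γ • f y := hxy
    rw [smul_sub, sub_eq_sub_iff_add_eq_add, add_comm (γ • f x)]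
    exact sub_eq_sub_iff_add_eq_add.mp h
  have hle : ‖x - y‖ ≤ γ * κ * ‖x - y‖ := by
    calc ‖x - y‖ = γ * ‖f x - f y‖ := by
          rw [hsub, norm_smul, Real.norm_of_nonneg hγ.le]
      _ ≤ γ * (κ * ‖x - y‖) := by gcongr; exact hf x y
      _ = γ * κ * ‖x - y‖ := by ring
  have hzero : ‖x - y‖ = 0 := by nlinarith [norm_nonneg (x - y)]
  exact sub_eq_zero.mp (norm_eq_zero.mp hzero)

/-- A Lipschitz bound for `x ↦ M (α L x + B (L x))` is one for `Dop α L c B M`. -/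
theorem isLipBound_Dop {H G : Type*} [NormedAddCommGroup H] [InnerProductSpace ℝ H]
    [NormedAddCommGroup G] [InnerProductSpace ℝ G] {κ α : ℝ} {L : H →L[ℝ] G} {B : G → G}
    {M : G →L[ℝ] H} (c : G) (h : IsLipBound κ fun x : H => M (α • L x + B (L x))) :
    IsLipBound κ (Dop α L c B M) := by
  intro x y
  have heq : Dop α L c B M x - Dop α L c B M y =
      M (α • L x + B (L x)) - M (α • L y + B (L y)) := by
    simp only [Dop, map_add, map_sub, map_smul, smul_sub]
    abel
  rw [heq]
  exact h x y

theorem statement14 {H G : Type*} [NormedAddCommGroup H] [InnerProductSpace ℝ H] [CompleteSpace H]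
    [NormedAddCommGroup G] [InnerProductSpace ℝ G] [CompleteSpace G]
    (ρ β ζ α : ℝ) (A : H → Set H) (C : H → H) (B : G → G)
    (L : H →L[ℝ] G) (K : G →L[ℝ] H) (c : G)
    (hA : IsMaxMonotoneSV ρ A)
    (hβ : 0 < β) (hC : IsCocoercive β C)
    (hζ : 0 < ζ) (hBmono : IsMonotoneMap B) (hBlip : IsLipBound ζ B)
    (hα : 0 ≤ α)
    (ζt : ℝ)
    (hζt : IsLipConst ζt (fun x : H => (ContinuousLinearMap.adjoint L - K) (B (L x))))
    (κ : ℝ) (hκ : IsLipConst κ (fun x : H => K (α • L x + B (L x))))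
    (hρhat : 0 ≤ (ρ + α * lambdaMin L K - ζt))
    (γ : ℝ) (hγ0 : 0 < γ)
    (hΓ₁ : κ ^ 2 * γ ^ 2 * (1 + γ / (2 * β)) < 1) (hΓ₂ : ρ * γ > -1)
    (J JC : H → H) (hJ : ∀ x y : H, J x = y ↔ x - y ∈ γ • A y)
    (hJC : ∀ x y : H, JC x = y ↔ x = y + γ • C y)
    (R V : H → H)
    (hRdef : ∀ z, R z = J ((2:ℝ) • JC z - z - γ • Dop α L c B K (JC z)))
    (hVdef : ∀ z, V z = R z - γ • Dop α L c B K (R z) + z -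
      (JC z - γ • Dop α L c B K (JC z))) :
    {x : H | ((0:H) ∈ (fun u => u + C x + Dop α L c B K x) '' A x)} = JC '' {z : H | V z = z} := by
  set D := Dop α L c B K with hD
  have hγκ : γ * κ < 1 := by
    have hpos : 0 ≤ κ ^ 2 * γ ^ 2 * (γ / (2 * β)) := by positivity
    have hsq : (γ * κ) ^ 2 < 1 := by nlinarith
    exact (abs_lt.mp ((sq_lt_one_iff_abs_lt_one _).mp hsq)).2
  have hinj : Function.Injective fun x => x - γ • D x :=
    (isLipBound_Dop c hκ.1).injective_sub_smul hγ0 hγκ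
  have hfix (z : H) : V z = z ↔ R z = JC z := by
    rw [hVdef, add_sub_right_comm, add_eq_right, sub_eq_zero]
    exact hinj.eq_iff
  have hzer (x : H) :
      (0 : H) ∈ (fun u => u + C x + D x) '' A x ↔ R (x + γ • C x) = x := by
    have hx : JC (x + γ • C x) = x := (hJC _ _).mpr rfl
    have harg : (2 : ℝ) • x - (x + γ • C x) - γ • D x - x = γ • (-(C x + D x)) := by
      module
    rw [hRdef, hx, hJ, harg, Set.smul_mem_smul_set_iff₀ hγ0.ne']
    constructor
    · rintro ⟨u, hu, h0⟩
      have hneg : u = -(C x + D x) := by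
        rw [← add_eq_zero_iff_eq_neg, ← add_assoc]
        exact h0
      exact hneg ▸ hu
    · intro h
      exact ⟨_, h, by dsimp only; abel⟩
  ext x
  simp only [Set.mem_ofPred_eq, Set.mem_image (f := JC), hfix]
  rw [hzer]
  constructor
  · intro h
    have hx : JC (x + γ • C x) = x := (hJC _ _).mpr rfl
    exact ⟨x + γ • C x, h.trans hx.symm, hx⟩
  · rintro ⟨z, hz, hzx⟩
    rw [← (hJC z x).mp hzx, hz, hzx]
end
end

section
/- Assume ρ̂ = ρ + αλ_min − ζ̃_{L*−K} ≥ 0, D_K is not the zero map, the mismatch assumption on (K_n) holds, and the set {x ∈ H : 0 ∈ A x + C x + D_K x} is nonempty. Let γ ∈ Γ, let z₀ ∈ H, and define for every n ∈ ℕ: x_n = J_{γC}(z_n), w_n = D_{K_n} x_n, y_n = J_{γA}(2x_n − z_n − γw_n), z_{n+1} = z_n + y_n − x_n − γ(D_{K_n} y_n − w_n). Then (z_n) converges weakly to some z̄ ∈ H with V^γ z̄ = z̄, and (x_n) converges weakly to J_{γC}(z̄), which satisfies 0 ∈ A(J_{γC} z̄) + C(J_{γC} z̄) + D_K(J_{γC}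 z̄). -/
open Filter Topology
open scoped RealInnerProductSpace Pointwise

noncomputable section

variable {H G : Type*}

/-! ### Weak limits and perturbed Fejér sequences -/

/-- A bounded family in a real Hilbert space converges weakly along every ultrafilter. -/
theorem exists_weak_limit_ultrafilter {ι H : Type*} [NormedAddCommGroup H] [InnerProductSpace ℝ H]
    [CompleteSpace H] (U : Ultrafilter ι) (f : ι → H) (M : ℝ) (hf : ∀ i, ‖f i‖ ≤ M) :
    ∃ a : H, ∀ v : H, Tendsto (fun i => ⟪f i, v⟫) U (𝓝 ⟪a, v⟫) := by
  let F : ι → WeakDual ℝ H := fun i => StrongDual.toWeakDual (InnerProductSpace.toDual ℝ H (f i))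
  have hK : IsCompact (WeakDual.toStrongDual ⁻¹'
      Metric.closedBall (0 : StrongDual ℝ H) M) := WeakDual.isCompact_closedBall 0 M
  have hmem : ∀ i, F i ∈ WeakDual.toStrongDual ⁻¹'
      Metric.closedBall (0 : StrongDual ℝ H) M := by
    intro i
    simpa [F] using hf i
  obtain ⟨φ, -, hφ⟩ := hK.ultrafilter_le_nhds (U.map F)
    (by rw [le_principal_iff]; exact Ultrafilter.mem_map.mpr (Filter.univ_mem' hmem))
  refine ⟨(InnerProductSpace.toDual ℝ H).symm (WeakDual.toStrongDual φ), fun v => ?_⟩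
  have h1 : Tendsto F U (𝓝 φ) := hφ
  have h2 := ((WeakDual.eval_continuous v).tendsto φ).comp h1
  rw [InnerProductSpace.toDual_symm_apply]
  exact h2

/-- Inner products of a bounded family with a strongly null family tend to zero. -/
theorem tendsto_inner_zero_of_bounded {ι H : Type*} [NormedAddCommGroup H] [InnerProductSpace ℝ H]
    {l : Filter ι} {f g : ι → H} {M : ℝ} (hf : ∀ i, ‖f i‖ ≤ M) (hg : Tendsto g l (𝓝 0)) :
    Tendsto (fun i => ⟪f i, g i⟫) l (𝓝 0) := by
  have hM : Tendsto (fun i => M * ‖g i‖) l (𝓝 0) := by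
    simpa using hg.norm.const_mul M
  refine squeeze_zero_norm (fun i => ?_) hM
  exact (norm_inner_le_norm _ _).trans (mul_le_mul_of_nonneg_right (hf i) (norm_nonneg _))

/-- A Fejér-type recursion whose relative errors are summable stays bounded. -/
theorem exists_bound_of_le_add_mul {a ω : ℕ → ℝ} {P : ℝ} (ha : ∀ n, 0 ≤ a n) (hP : 0 ≤ P)
    (hω : ∀ n, 0 ≤ ω n) (hs : Summable ω)
    (hrec : ∀ n, a (n + 1) ≤ a n + P * ω n * (a n + 1)) : ∃ M, ∀ n, a n ≤ M := by
  have key : ∀ n, a n + 1 ≤ (a 0 + 1) * Real.exp (P * ∑ i ∈ Finset.range n, ω i) := by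
    intro n
    induction n with
    | zero => simp
    | succ n ih =>
      have h0 : 0 ≤ P * ω n := mul_nonneg hP (hω n)
      rw [Finset.sum_range_succ, mul_add, Real.exp_add, ← mul_assoc]
      calc a (n + 1) + 1 ≤ (a n + 1) * (P * ω n + 1) := by linarith [hrec n]
        _ ≤ _ := mul_le_mul ih (Real.add_one_le_exp _) (by linarith)
              (by have := ha 0; positivity)
  refine ⟨(a 0 + 1) * Real.exp (P * ∑' i, ω i), fun n => ?_⟩
  have h1 : ∑ i ∈ Finset.range n, ω i ≤ ∑' i, ω i := hs.sum_le_tsum _ (fun i _ => hω i)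
  have h2 : (a 0 + 1) * Real.exp (P * ∑ i ∈ Finset.range n, ω i)
      ≤ (a 0 + 1) * Real.exp (P * ∑' i, ω i) := by
    have := ha 0
    gcongr
  linarith [key n]

/-- A nonnegative sequence that decreases up to summable errors converges. -/
theorem exists_tendsto_of_le_add_summable {a ε : ℕ → ℝ} (ha : ∀ n, 0 ≤ a n)
    (hs : Summable ε) (hrec : ∀ n, a (n + 1) ≤ a n + ε n) : ∃ ℓ, Tendsto a atTop (𝓝 ℓ) := by
  have hsum := hs.hasSum.tendsto_sum_nat
  have hanti : Antitone fun n => a n - ∑ i ∈ Finset.range n, ε i := by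
    refine antitone_nat_of_succ_le fun n => ?_
    rw [Finset.sum_range_succ]
    linarith [hrec n]
  obtain ⟨b, hb⟩ := hsum.bddAbove_range
  have hbdd : BddBelow (Set.range fun n => a n - ∑ i ∈ Finset.range n, ε i) := by
    refine ⟨-b, ?_⟩
    rintro _ ⟨n, rfl⟩
    have := hb ⟨n, rfl⟩
    have := ha n
    dsimp only at *
    linarith
  refine ⟨_, ((tendsto_atTop_ciInf hanti hbdd).add hsum).congr fun n => ?_⟩
  ring

/-- Opial's lemma, with cluster points taken along ultrafilters. -/
theorem exists_weak_limit_of_opial {H : Type*} [NormedAddCommGroup H] [InnerProductSpace ℝ H]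
    [CompleteSpace H] {z : ℕ → H} {S : Set H} {M : ℝ} (hz : ∀ n, ‖z n‖ ≤ M)
    (hfejer : ∀ s ∈ S, ∃ ℓ, Tendsto (fun n => ‖z n - s‖) atTop (𝓝 ℓ))
    (hcluster : ∀ (U : Ultrafilter ℕ) (a : H), (U : Filter ℕ) ≤ atTop →
      (∀ v, Tendsto (fun n => ⟪z n, v⟫) U (𝓝 ⟪a, v⟫)) → a ∈ S) :
    ∃ a ∈ S, ∀ v, Tendsto (fun n => ⟪z n, v⟫) atTop (𝓝 ⟪a, v⟫) := by
  have huniq : ∀ (U U' : Ultrafilter ℕ) (a a' : H), (U : Filter ℕ) ≤ atTop →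
      (U' : Filter ℕ) ≤ atTop →
      (∀ v, Tendsto (fun n => ⟪z n, v⟫) U (𝓝 ⟪a, v⟫)) →
      (∀ v, Tendsto (fun n => ⟪z n, v⟫) U' (𝓝 ⟪a', v⟫)) → a = a' := by
    intro U U' a a' hU hU' ha ha'
    obtain ⟨ℓ, hℓ⟩ := hfejer a (hcluster U a hU ha)
    obtain ⟨ℓ', hℓ'⟩ := hfejer a' (hcluster U' a' hU' ha')
    have hlim : Tendsto (fun n => ⟪z n, a - a'⟫) atTop
        (𝓝 ((ℓ' ^ 2 - ℓ ^ 2 + ‖a‖ ^ 2 - ‖a'‖ ^ 2) / 2)) := by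
      refine (((((hℓ'.pow 2).sub (hℓ.pow 2)).add_const _).sub_const _).div_const 2).congr
        fun n => ?_
      rw [norm_sub_sq_real, norm_sub_sq_real, inner_sub_right]
      ring
    have e1 := tendsto_nhds_unique (ha (a - a')) (hlim.mono_left hU)
    have e2 := tendsto_nhds_unique (ha' (a - a')) (hlim.mono_left hU')
    have h0 : ⟪a - a', a - a'⟫ = (0 : ℝ) := by
      rw [inner_sub_left, e1, e2, sub_self]
    exact sub_eq_zero.mp (inner_self_eq_zero.mp h0)
  obtain ⟨a, ha⟩ := exists_weak_limit_ultrafilter (Ultrafilter.of atTop) z M hz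
  have hle : ((Ultrafilter.of atTop : Ultrafilter ℕ) : Filter ℕ) ≤ atTop := Ultrafilter.of_le _
  refine ⟨a, hcluster _ a hle ha, fun v => ?_⟩
  rw [tendsto_iff_ultrafilter]
  intro U hU
  obtain ⟨a', ha'⟩ := exists_weak_limit_ultrafilter U z M hz
  rw [huniq _ U a a' hle hU ha ha']
  exact ha' v

/-! ### Resolvents and the forward-backward-half-forward step -/

/-- The resolvent of `γA` is Lipschitz when `A` is `ρ`-monotone. -/
theorem resolvent_lipschitz {H : Type*} [NormedAddCommGroup H] [InnerProductSpace ℝ H]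
    {ρ γ : ℝ} {A : H → Set H} {J : H → H} (hA : IsMonotoneSV ρ A) (hγ : 0 < γ)
    (hJ : ∀ x y : H, J x = y ↔ x - y ∈ γ • A y) (a b : H) :
    (1 + ρ * γ) * ‖J a - J b‖ ≤ ‖a - b‖ := by
  obtain ⟨u, hu, hua⟩ := Set.mem_smul_set.mp ((hJ a _).mp rfl)
  obtain ⟨v, hv, hvb⟩ := Set.mem_smul_set.mp ((hJ b _).mp rfl)
  have hm := mul_le_mul_of_nonneg_left (hA _ _ u v hu hv) hγ.le
  rw [← real_inner_smul_right, smul_sub, hua, hvb,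
    show a - J a - (b - J b) = (a - b) - (J a - J b) by abel, inner_sub_right,
    real_inner_self_eq_norm_sq] at hm
  have h1 := real_inner_le_norm (J a - J b) (a - b)
  by_contra! h
  have h2 : 0 < ‖J a - J b‖ := by
    refine (norm_nonneg _).lt_of_ne fun h0 => ?_
    rw [← h0] at h
    linarith [norm_nonneg (a - b)]
  nlinarith [mul_lt_mul_of_pos_left h h2]

/-- The resolvent of `γC` is nonexpansive when `C` is cocoercive. -/
theorem cocoercive_resolvent_nonexpansive {H : Type*} [NormedAddCommGroup H]
    [InnerProductSpace ℝ H] {β γ : ℝ} {C JC : H → H} (hC : IsCocoercive β C) (hβ : 0 < β)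
    (hγ : 0 < γ) (hJC : ∀ x y : H, JC x = y ↔ x = y + γ • C y) (a b : H) :
    ‖JC a - JC b‖ ≤ ‖a - b‖ := by
  have ha := (hJC a _).mp rfl
  have hb := (hJC b _).mp rfl
  set p := JC a
  set q := JC b
  have hc : (0 : ℝ) ≤ ⟪p - q, C p - C q⟫ := le_trans (by positivity) (hC p q)
  have hab : a - b = (p - q) + γ • (C p - C q) := by
    rw [ha, hb]; module
  have h1 : ‖p - q‖ ^ 2 ≤ ‖p - q‖ * ‖a - b‖ := by
    refine le_trans ?_ (real_inner_le_norm (p - q) (a - b))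
    rw [hab, inner_add_right, real_inner_self_eq_norm_sq, real_inner_smul_right]
    have := mul_nonneg hγ.le hc
    linarith
  by_contra! h
  nlinarith [norm_nonneg (a - b), norm_nonneg (p - q)]

/-- The descent inequality behind one exact step, in terms of `s = x - x̄`, `c = Cx - Cx̄`,
`q = p - x` and `e = γ(Dp - Dx)`. -/
theorem fbhf_descent {H : Type*} [NormedAddCommGroup H] [InnerProductSpace ℝ H]
    {β γ κ : ℝ} (hβ : 0 < β) (hγ : 0 < γ) {s c q e : H}
    (hc : β * ‖c‖ ^ 2 ≤ ⟪s, c⟫) (hm : (0 : ℝ) ≤ ⟪q + s, -(q - e) - γ • c⟫)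
    (he : ‖e‖ ^ 2 ≤ κ ^ 2 * γ ^ 2 * ‖q‖ ^ 2) :
    ‖s + γ • c + (q - e)‖ ^ 2 ≤
      ‖s + γ • c‖ ^ 2 - (1 - κ ^ 2 * γ ^ 2 * (1 + γ / (2 * β))) * ‖q‖ ^ 2 := by
  have hcs := mul_le_mul_of_nonneg_left hc hγ.le
  have hsq : 0 ≤ γ / (2 * β) * ‖(2 * β) • c + e‖ ^ 2 := by positivity
  have hexp : γ / (2 * β) * ‖(2 * β) • c + e‖ ^ 2
      = 2 * β * γ * ‖c‖ ^ 2 + 2 * γ * ⟪c, e⟫ + γ / (2 * β) * ‖e‖ ^ 2 := by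
    rw [norm_add_sq_real, norm_smul, real_inner_smul_left, mul_pow, Real.norm_eq_abs, sq_abs]
    field_simp
  have he' := mul_le_mul_of_nonneg_left he (by positivity : 0 ≤ 1 + γ / (2 * β))
  rw [norm_add_sq_real, norm_sub_sq_real]
  simp only [inner_add_left, inner_sub_right, inner_neg_right, real_inner_smul_left,
    real_inner_smul_right, real_inner_self_eq_norm_sq] at hm ⊢
  rw [real_inner_comm q c]
  linarith

/-- Weak closedness of the sum of a cocoercive map and a monotone operator `A + D` along
sequences of approximate solutions. -/
theorem fbhf_demiclosed {ι H : Type*} [NormedAddCommGroup H] [InnerProductSpace ℝ H]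
    {β γ κ : ℝ} {A : H → Set H} {C D J : H → H} (hβ : 0 < β) (hC : IsCocoercive β C)
    (hγ : 0 < γ) (hD : IsLipBound κ D) (hγκ : γ * κ < 1)
    (hAD : ∀ x y u v, u ∈ A x → v ∈ A y → (0 : ℝ) ≤ ⟪x - y, (u + D x) - (v + D y)⟫)
    (hJ : ∀ x y : H, J x = y ↔ x - y ∈ γ • A y)
    {l : Filter ι} [l.NeBot] {x q r : ι → H} {a u : H} {M N : ℝ}
    (hx : ∀ i, ‖x i‖ ≤ M) (hCx : ∀ i, ‖C (x i)‖ ≤ N)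
    (hq : Tendsto q l (𝓝 0)) (hr : Tendsto r l (𝓝 0))
    (hmem : ∀ i, r i - C (x i) - D (x i + q i) ∈ A (x i + q i))
    (hxa : ∀ v, Tendsto (fun i => ⟪x i, v⟫) l (𝓝 ⟪a, v⟫))
    (hCu : ∀ v, Tendsto (fun i => ⟪C (x i), v⟫) l (𝓝 ⟪u, v⟫)) :
    C a = u ∧ -(C a + D a) ∈ A a := by
  have key : ∀ a₁ b₁ a₂, b₁ ∈ A a₁ →
      (0 : ℝ) ≤ ⟪a - a₁, -u - (b₁ + D a₁)⟫ + ⟪a - a₂, u - C a₂⟫ := by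
    intro a₁ b₁ a₂ hb
    have hlim : Tendsto (fun i => ⟪(x i + q i) - a₁, (r i - C (x i)) - (b₁ + D a₁)⟫
        + ⟪x i - a₂, C (x i) - C a₂⟫) l
        (𝓝 (⟪a - a₁, -u - (b₁ + D a₁)⟫ + ⟪a - a₂, u - C a₂⟫)) := by
      have t1 := tendsto_inner_zero_of_bounded hx hr
      have t2 := tendsto_inner_zero_of_bounded hCx hq
      have t3 : Tendsto (fun i => ⟪q i - a₁, r i⟫) l (𝓝 0) := by
        simpa using (hq.sub_const a₁).inner (𝕜 := ℝ) hr
      have t4 : Tendsto (fun i => ⟪q i, b₁ + D a₁⟫) l (𝓝 0) := by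
        simpa using hq.inner (𝕜 := ℝ) (tendsto_const_nhds (x := b₁ + D a₁))
      have t5 := hxa (b₁ + D a₁)
      have t6 := hxa (C a₂)
      have t7 := hCu a₁
      have t8 := hCu a₂
      have t := ((((((((t1.sub t2).add t3).sub t4).sub t5).sub t6).add t7).sub t8).add_const
        (⟪a₁, b₁ + D a₁⟫ + ⟪a₂, C a₂⟫))
      convert t using 2
      · simp only [inner_sub_left, inner_sub_right, inner_add_left, inner_add_right]
        rw [real_inner_comm (q _) (C (x _)), real_inner_comm a₁ (C (x _)),
          real_inner_comm a₂ (C (x _))]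
        ring
      · simp only [inner_sub_left, inner_sub_right, inner_add_right, inner_neg_right]
        rw [real_inner_comm a₁ u, real_inner_comm a₂ u]
        ring
    refine ge_of_tendsto' hlim fun i => add_nonneg ?_ (le_trans (by positivity) (hC _ _))
    have := hAD _ _ _ _ (hmem i) hb
    rwa [sub_add_cancel] at this
  have hmemA : -u - D a ∈ A a := by
    set k := -u - D a
    obtain ⟨b, hb, hbJ⟩ := Set.mem_smul_set.mp ((hJ (a + γ • k) _).mp rfl)
    set a₁ := J (a + γ • k)
    have h1 := key a₁ b a hb
    rw [sub_self, inner_zero_left, add_zero] at h1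
    have h2 : γ • (-u - (b + D a₁)) = -(a - a₁) + γ • (D a - D a₁) := by
      have : γ • (-u - (b + D a₁)) = γ • k - γ • b + γ • (D a - D a₁) := by
        simp only [k]; module
      rw [this, hbJ]; abel
    have h3 := mul_nonneg hγ.le h1
    rw [← real_inner_smul_right, h2, inner_add_right, inner_neg_right,
      real_inner_self_eq_norm_sq, real_inner_smul_right] at h3
    have h4 : ⟪a - a₁, D a - D a₁⟫ ≤ ‖a - a₁‖ * (κ * ‖a - a₁‖) :=
      (real_inner_le_norm _ _).trans
        (mul_le_mul_of_nonneg_left (hD _ _) (norm_nonneg _))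
    have h5 : ‖a - a₁‖ = 0 := by
      have := mul_le_mul_of_nonneg_left h4 hγ.le
      by_contra h
      have : 0 < ‖a - a₁‖ ^ 2 := by positivity
      nlinarith
    have h6 : a₁ = a := (sub_eq_zero.mp (norm_eq_zero.mp h5)).symm
    rw [h6, add_sub_cancel_left] at hbJ
    rw [h6] at hb
    rwa [← smul_right_injective H hγ.ne' hbJ]
  have hu : C a = u := by
    set s := u - C a with hs
    have h1 := key a _ (a + (β / 2) • s) hmemA
    rw [sub_self, inner_zero_left, zero_add, sub_add_cancel_left, inner_neg_left,
      real_inner_smul_left] at h1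
    have h2 : ⟪s, u - C (a + (β / 2) • s)⟫
        = ‖s‖ ^ 2 - ⟪s, C (a + (β / 2) • s) - C a⟫ := by
      rw [← real_inner_self_eq_norm_sq, ← inner_sub_right]
      congr 1
      rw [hs]; abel
    set d := C (a + (β / 2) • s) - C a
    have h3 : β * ‖d‖ ^ 2 ≤ β / 2 * ⟪s, d⟫ := by
      have := hC (a + (β / 2) • s) a
      rwa [add_sub_cancel_left, real_inner_smul_left] at this
    have h4 := real_inner_le_norm s d
    have h5 : ‖s‖ ^ 2 ≤ ⟪s, d⟫ := by
      have : 0 < β / 2 := by positivity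
      nlinarith
    have h6 : ‖d‖ ^ 2 ≤ ⟪s, d⟫ / 2 := by nlinarith
    have h7 : ‖s‖ = 0 := by
      nlinarith [sq_nonneg (‖s‖ - ‖d‖), norm_nonneg s, norm_nonneg d]
    exact (sub_eq_zero.mp (norm_eq_zero.mp h7)).symm
  refine ⟨hu, ?_⟩
  rw [hu, neg_add']
  exact hmemA

/-- One exact step decreases the distance to every `s` whose resolvent `JC s` solves the
inclusion. -/
theorem fbhf_step_fejer {H : Type*} [NormedAddCommGroup H] [InnerProductSpace ℝ H]
    {β γ κ : ℝ} {A : H → Set H} {C D J JC R V : H → H} (hβ : 0 < β) (hC : IsCocoercive β C)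
    (hγ : 0 < γ) (hD : IsLipBound κ D)
    (hAD : ∀ x y u v, u ∈ A x → v ∈ A y → (0 : ℝ) ≤ ⟪x - y, (u + D x) - (v + D y)⟫)
    (hJ : ∀ x y : H, J x = y ↔ x - y ∈ γ • A y)
    (hJC : ∀ x y : H, JC x = y ↔ x = y + γ • C y)
    (hR : ∀ z, R z = J ((2 : ℝ) • JC z - z - γ • D (JC z)))
    (hV : ∀ z, V z = R z - γ • D (R z) + z - (JC z - γ • D (JC z)))
    {s : H} (hs : -(C (JC s) + D (JC s)) ∈ A (JC s)) (z : H) :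
    ‖V z - s‖ ^ 2 ≤
      ‖z - s‖ ^ 2 - (1 - κ ^ 2 * γ ^ 2 * (1 + γ / (2 * β))) * ‖R z - JC z‖ ^ 2 := by
  have hz := (hJC z _).mp rfl
  have hs' := (hJC s _).mp rfl
  obtain ⟨u, hu, hup⟩ := Set.mem_smul_set.mp ((hJ _ _).mp (hR z).symm)
  have hm := mul_nonneg hγ.le (hAD _ _ _ _ hu hs)
  rw [hV z]
  set x := JC z
  set p := R z
  set t := JC s
  have e1 : z - s = (x - t) + γ • (C x - C t) := by
    rw [hz, hs']; module
  have e2 : p - γ • D p + z - (x - γ • D x) - s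
      = (x - t) + γ • (C x - C t) + ((p - x) - γ • (D p - D x)) := by
    rw [hz, hs']; module
  rw [e1, e2]
  refine fbhf_descent hβ hγ (hC x t) ?_ ?_
  · rw [← real_inner_smul_right] at hm
    have e3 : -((p - x) - γ • (D p - D x)) - γ • (C x - C t)
        = γ • (u + D p - (-(C t + D t) + D t)) := by
      rw [smul_sub γ (u + D p), smul_add γ u, hup, hz]
      module
    rwa [sub_add_sub_cancel, e3]
  · rw [norm_smul, mul_pow, Real.norm_eq_abs, sq_abs]
    have := pow_le_pow_left₀ (norm_nonneg _) (hD p x) 2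
    rw [mul_pow] at this
    have := mul_le_mul_of_nonneg_left this (sq_nonneg γ)
    linarith

/-- Weak convergence of the forward-backward-half-forward iteration under errors that are
summable relative to the size of the iterates. -/
theorem fbhf_weak_convergence {H : Type*} [NormedAddCommGroup H] [InnerProductSpace ℝ H]
    [CompleteSpace H] {β γ κ P : ℝ} {A : H → Set H} {C D J JC R V : H → H}
    (hβ : 0 < β) (hC : IsCocoercive β C) (hγ : 0 < γ) (hD : IsLipBound κ D)
    (hΓ : κ ^ 2 * γ ^ 2 * (1 + γ / (2 * β)) < 1)
    (hAD : ∀ x y u v, u ∈ A x → v ∈ A y → (0 : ℝ) ≤ ⟪x - y, (u + D x) - (v + D y)⟫)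
    (hJ : ∀ x y : H, J x = y ↔ x - y ∈ γ • A y)
    (hJC : ∀ x y : H, JC x = y ↔ x = y + γ • C y)
    (hR : ∀ z, R z = J ((2 : ℝ) • JC z - z - γ • D (JC z)))
    (hV : ∀ z, V z = R z - γ • D (R z) + z - (JC z - γ • D (JC z)))
    (hsol : ∃ x, -(C x + D x) ∈ A x)
    {z : ℕ → H} {ω : ℕ → ℝ} (hP : 0 ≤ P) (hω : ∀ n, 0 ≤ ω n) (hωs : Summable ω)
    (hz : ∀ n, ‖z (n + 1) - V (z n)‖ ≤ P * ω n * (‖z n‖ + 1)) :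
    ∃ s, V s = s ∧ -(C (JC s) + D (JC s)) ∈ A (JC s) ∧
      (∀ v, Tendsto (fun n => ⟪z n, v⟫) atTop (𝓝 ⟪s, v⟫)) ∧
      (∀ v, Tendsto (fun n => ⟪JC (z n), v⟫) atTop (𝓝 ⟪JC s, v⟫)) := by
  set δ := 1 - κ ^ 2 * γ ^ 2 * (1 + γ / (2 * β))
  have hδ : 0 < δ := by linarith
  have hγκ : γ * κ < 1 := by
    have h1 : 0 ≤ κ ^ 2 * γ ^ 2 * (γ / (2 * β)) := by positivity
    have h2 : (γ * κ) ^ 2 < 1 := by nlinarith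
    exact lt_of_pow_lt_pow_left₀ 2 zero_le_one (by rwa [one_pow])
  set S : Set H := {s | -(C (JC s) + D (JC s)) ∈ A (JC s)} with hS
  have hstep : ∀ s ∈ S, ∀ y, ‖V y - s‖ ^ 2 ≤ ‖y - s‖ ^ 2 - δ * ‖R y - JC y‖ ^ 2 :=
    fun s hs y => fbhf_step_fejer hβ hC hγ hD hAD hJ hJC hR hV hs y
  have hquasi : ∀ s ∈ S, ∀ y, ‖V y - s‖ ≤ ‖y - s‖ := fun s hs y => by
    have := hstep s hs y
    refine le_of_sq_le_sq ?_ (norm_nonneg _)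
    have : 0 ≤ δ * ‖R y - JC y‖ ^ 2 := by positivity
    linarith
  obtain ⟨x₀, hx₀⟩ := hsol
  obtain ⟨s₀, hs₀⟩ : S.Nonempty := by
    refine ⟨x₀ + γ • C x₀, ?_⟩
    have : JC (x₀ + γ • C x₀) = x₀ := (hJC _ _).mpr rfl
    simpa only [hS, Set.mem_ofPred_eq, this] using hx₀
  obtain ⟨M, hM⟩ : ∃ M, ∀ n, ‖z n‖ ≤ M := by
    obtain ⟨M, hM⟩ := exists_bound_of_le_add_mul (a := fun n => ‖z n - s₀‖)
      (P := P * (1 + ‖s₀‖)) (fun n => norm_nonneg _) (by positivity) hω hωs fun n => by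
        have h1 : ‖z n‖ ≤ ‖z n - s₀‖ + ‖s₀‖ := norm_le_norm_sub_add _ _
        have h2 : ‖z n‖ + 1 ≤ (1 + ‖s₀‖) * (‖z n - s₀‖ + 1) := by
          nlinarith [norm_nonneg s₀, norm_nonneg (z n - s₀)]
        have h3 := mul_le_mul_of_nonneg_left h2 (mul_nonneg hP (hω n))
        have h4 := norm_sub_le_norm_sub_add_norm_sub (z (n + 1)) (V (z n)) s₀
        linarith [hz n, hquasi s₀ hs₀ (z n)]
    exact ⟨M + ‖s₀‖, fun n =>
      (norm_le_norm_sub_add _ s₀).trans (add_le_add_left (hM n) _)⟩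
  have herr : Summable fun n => P * (M + 1) * ω n := hωs.mul_left _
  have hz' : ∀ n, ‖z (n + 1) - V (z n)‖ ≤ P * (M + 1) * ω n := fun n => by
    have := mul_le_mul_of_nonneg_left (add_le_add_left (hM n) 1) (mul_nonneg hP (hω n))
    linarith [hz n]
  have hfejer : ∀ s ∈ S, ∃ ℓ, Tendsto (fun n => ‖z n - s‖) atTop (𝓝 ℓ) := fun s hs =>
    exists_tendsto_of_le_add_summable (fun n => norm_nonneg _) herr fun n => by
      have h4 := norm_sub_le_norm_sub_add_norm_sub (z (n + 1)) (V (z n)) s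
      linarith [hz' n, hquasi s hs (z n)]
  have hq : Tendsto (fun n => R (z n) - JC (z n)) atTop (𝓝 0) := by
    obtain ⟨ℓ, hℓ⟩ := hfejer s₀ hs₀
    have hVℓ : Tendsto (fun n => ‖V (z n) - s₀‖) atTop (𝓝 ℓ) := by
      have hlow := ((tendsto_add_atTop_iff_nat 1).mpr hℓ).sub herr.tendsto_atTop_zero
      rw [sub_zero] at hlow
      refine tendsto_of_tendsto_of_tendsto_of_le_of_le hlow hℓ (fun n => ?_)
        (fun n => hquasi s₀ hs₀ (z n))
      have h4 := norm_sub_le_norm_sub_add_norm_sub (z (n + 1)) (V (z n)) s₀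
      dsimp only
      linarith [hz' n]
    have h0 := ((hℓ.pow 2).sub (hVℓ.pow 2)).div_const δ
    rw [sub_self, zero_div] at h0
    have h1 : Tendsto (fun n => ‖R (z n) - JC (z n)‖ ^ 2) atTop (𝓝 0) := by
      refine squeeze_zero (fun n => by positivity) (fun n => ?_) h0
      rw [le_div_iff₀ hδ]
      linarith [hstep s₀ hs₀ (z n)]
    rw [tendsto_zero_iff_norm_tendsto_zero]
    simpa using h1.sqrt
  obtain ⟨N, hN⟩ : ∃ N, ∀ n, ‖JC (z n)‖ ≤ N := by
    refine ⟨M + ‖s₀‖ + ‖JC s₀‖, fun n => ?_⟩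
    have h1 := cocoercive_resolvent_nonexpansive hC hβ hγ hJC (z n) s₀
    have h2 := norm_le_norm_sub_add (JC (z n)) (JC s₀)
    linarith [norm_sub_le (z n) s₀, hM n]
  have hCz : ∀ n, C (JC (z n)) = γ⁻¹ • (z n - JC (z n)) := fun n => by
    rw [eq_inv_smul_iff₀ hγ.ne', eq_sub_iff_add_eq', ← (hJC (z n) _).mp rfl]
  have hCN : ∀ n, ‖C (JC (z n))‖ ≤ γ⁻¹ * (M + N) := fun n => by
    rw [hCz, norm_smul, Real.norm_eq_abs, abs_of_pos (inv_pos.mpr hγ)]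
    gcongr
    exact (norm_sub_le _ _).trans (add_le_add (hM n) (hN n))
  have hr : Tendsto (fun n => (D (R (z n)) - D (JC (z n))) - γ⁻¹ • (R (z n) - JC (z n)))
      atTop (𝓝 0) := by
    have h1 : Tendsto (fun n => D (R (z n)) - D (JC (z n))) atTop (𝓝 0) := by
      refine squeeze_zero_norm (fun n => hD _ _) ?_
      simpa using hq.norm.const_mul κ
    simpa using h1.sub (hq.const_smul γ⁻¹)
  have hmem : ∀ n, ((D (R (z n)) - D (JC (z n))) - γ⁻¹ • (R (z n) - JC (z n)))
      - C (JC (z n)) - D (JC (z n) + (R (z n) - JC (z n))) ∈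
        A (JC (z n) + (R (z n) - JC (z n))) := by
    intro n
    obtain ⟨u, hu, hup⟩ := Set.mem_smul_set.mp ((hJ _ _).mp (hR (z n)).symm)
    rw [add_sub_cancel]
    convert hu using 1
    rw [← inv_smul_smul₀ hγ.ne' u, hup, hCz]
    simp only [smul_sub, inv_smul_smul₀ hγ.ne']
    module
  have hcluster : ∀ (U : Ultrafilter ℕ) (a : H), (U : Filter ℕ) ≤ atTop →
      (∀ v, Tendsto (fun n => ⟪z n, v⟫) U (𝓝 ⟪a, v⟫)) →
      a ∈ S ∧ ∀ v, Tendsto (fun n => ⟪JC (z n), v⟫) U (𝓝 ⟪JC a, v⟫) := by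
    intro U a hU ha
    obtain ⟨x, hx⟩ := exists_weak_limit_ultrafilter U (fun n => JC (z n)) N hN
    have hCx : ∀ v, Tendsto (fun n => ⟪C (JC (z n)), v⟫) U (𝓝 ⟪γ⁻¹ • (a - x), v⟫) := by
      intro v
      simp only [hCz, real_inner_smul_left, inner_sub_left]
      exact ((ha v).sub (hx v)).const_mul _
    obtain ⟨h1, h2⟩ := fbhf_demiclosed hβ hC hγ hD hγκ hAD hJ hN hCN (hq.mono_left hU)
      (hr.mono_left hU) hmem hx hCx
    have h3 : JC a = x := by
      rw [hJC, h1, smul_inv_smul₀ hγ.ne', add_sub_cancel]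
    simp only [hS, Set.mem_ofPred_eq, h3]
    exact ⟨h2, hx⟩
  obtain ⟨s, hs, hzs⟩ := exists_weak_limit_of_opial hM hfejer
    fun U a hU ha => (hcluster U a hU ha).1
  refine ⟨s, ?_, hs, hzs, fun v => ?_⟩
  · have := hquasi s hs s
    rw [sub_self, norm_zero] at this
    exact sub_eq_zero.mp (norm_le_zero_iff.mp this)
  · rw [tendsto_iff_ultrafilter]
    intro U hU
    exact (hcluster U s hU fun v => (hzs v).mono_left hU).2 v

/-! ### The operator `Dop` -/

/-- `lambdaMin` bounds the quadratic form of `K ∘ L` from below. -/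
theorem lambdaMin_mul_norm_sq_le {H G : Type*} [NormedAddCommGroup H] [InnerProductSpace ℝ H]
    [NormedAddCommGroup G] [InnerProductSpace ℝ G] (L : H →L[ℝ] G) (K : G →L[ℝ] H) (x : H) :
    lambdaMin L K * ‖x‖ ^ 2 ≤ ⟪x, K (L x)⟫ := by
  rcases eq_or_ne x 0 with rfl | hx
  · simp
  have hx' : 0 < ‖x‖ := norm_pos_iff.mpr hx
  have hbdd : BddBelow {r : ℝ | ∃ x : H, ‖x‖ = 1 ∧ r = ⟪x, K (L x)⟫} := by
    refine ⟨-‖K.comp L‖, ?_⟩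
    rintro _ ⟨y, hy, rfl⟩
    have h1 := abs_real_inner_le_norm y (K (L y))
    have h2 := (K.comp L).le_opNorm y
    rw [hy, mul_one, ContinuousLinearMap.comp_apply] at h2
    rw [hy, one_mul] at h1
    linarith [neg_abs_le (⟪y, K (L y)⟫ : ℝ)]
  have h := csInf_le hbdd ⟨‖x‖⁻¹ • x, by rw [norm_smul, norm_inv, norm_norm,
    inv_mul_cancel₀ hx'.ne'], rfl⟩
  rw [map_smul, map_smul, real_inner_smul_left, real_inner_smul_right] at h
  have h1 := mul_le_mul_of_nonneg_right h (sq_nonneg ‖x‖)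
  refine h1.trans_eq ?_
  field_simp

/-- Strong monotonicity (possibly with a negative modulus) of `Dop`. -/
theorem dop_inner_sub_le {H G : Type*} [NormedAddCommGroup H] [InnerProductSpace ℝ H]
    [CompleteSpace H] [NormedAddCommGroup G] [InnerProductSpace ℝ G] [CompleteSpace G]
    {α ζt : ℝ} {B : G → G} {L : H →L[ℝ] G} {K : G →L[ℝ] H} (c : G)
    (hB : IsMonotoneMap B) (hα : 0 ≤ α)
    (hζt : IsLipBound ζt (fun x : H => (ContinuousLinearMap.adjoint L - K) (B (L x))))
    (x y : H) :
    (α * lambdaMin L K - ζt) * ‖x - y‖ ^ 2 ≤ ⟪x - y, Dop α L c B K x - Dop α L c B K y⟫ := by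
  have e : Dop α L c B K x - Dop α L c B K y
      = α • K (L (x - y)) + ContinuousLinearMap.adjoint L (B (L x) - B (L y))
        - ((ContinuousLinearMap.adjoint L - K) (B (L x))
          - (ContinuousLinearMap.adjoint L - K) (B (L y))) := by
    simp only [Dop, map_sub, sub_apply, smul_sub]
    abel
  have h1 := mul_le_mul_of_nonneg_left (lambdaMin_mul_norm_sq_le L K (x - y)) hα
  have h2 := hB (L x) (L y)
  have h3 := (real_inner_le_norm (x - y) _).trans
    (mul_le_mul_of_nonneg_left (hζt x y) (norm_nonneg (x - y)))
  rw [e, inner_sub_right, inner_add_right, real_inner_smul_right,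
    ContinuousLinearMap.adjoint_inner_right, map_sub L x y]
  rw [map_sub L x y] at h1
  linarith

/-- `Dop` inherits the Lipschitz bound of `x ↦ K (α L x + B (L x))`. -/
theorem dop_lipBound {H G : Type*} [NormedAddCommGroup H] [InnerProductSpace ℝ H]
    [NormedAddCommGroup G] [InnerProductSpace ℝ G]
    {α κ : ℝ} {B : G → G} {L : H →L[ℝ] G} {K : G →L[ℝ] H} (c : G)
    (hκ : IsLipBound κ (fun x : H => K (α • L x + B (L x)))) :
    IsLipBound κ (Dop α L c B K) := by
  intro x y
  have e : Dop α L c B K x - Dop α L c B K y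
      = K (α • L x + B (L x)) - K (α • L y + B (L y)) := by
    simp only [Dop, map_sub, map_add, map_smul, smul_sub]
    abel
  rw [e]
  exact hκ x y

/-- `Dop` depends on the last operator in a Lipschitz way, with affine growth in the point. -/
theorem exists_norm_dop_sub_dop_le {H G : Type*} [NormedAddCommGroup H] [InnerProductSpace ℝ H]
    [NormedAddCommGroup G] [InnerProductSpace ℝ G]
    {ζ : ℝ} (α : ℝ) {B : G → G} (hζ : 0 ≤ ζ) (hB : IsLipBound ζ B) (L : H →L[ℝ] G) (c : G) :
    ∃ N, 0 ≤ N ∧ ∀ (M M' : G →L[ℝ] H) (x : H),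
      ‖Dop α L c B M x - Dop α L c B M' x‖ ≤ ‖M - M'‖ * (N * (‖x‖ + 1)) := by
  refine ⟨|α| * (‖L‖ + ‖c‖) + (ζ * ‖L‖ + ‖B 0‖), by positivity, fun M M' x => ?_⟩
  have e : Dop α L c B M x - Dop α L c B M' x = (M - M') (α • (L x - c) + B (L x)) := by
    simp only [Dop, map_add, map_sub, map_smul, sub_apply, smul_sub]
    abel
  rw [e]
  refine ((M - M').le_opNorm _).trans (mul_le_mul_of_nonneg_left ?_ (norm_nonneg _))
  have hL := L.le_opNorm x
  have h1 : ‖α • (L x - c)‖ ≤ |α| * (‖L‖ * ‖x‖ + ‖c‖) := by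
    rw [norm_smul, Real.norm_eq_abs]
    exact mul_le_mul_of_nonneg_left ((norm_sub_le _ _).trans (by linarith)) (abs_nonneg _)
  have h2 : ‖B (L x)‖ ≤ ζ * (‖L‖ * ‖x‖) + ‖B 0‖ := by
    have h3 := hB (L x) 0
    rw [sub_zero] at h3
    have h4 := norm_le_norm_sub_add (B (L x)) (B 0)
    linarith [mul_le_mul_of_nonneg_left hL hζ]
  have h5 := norm_add_le (α • (L x - c)) (B (L x))
  have h6 : 0 ≤ |α| * ‖L‖ := by positivity
  have h7 : 0 ≤ |α| * ‖c‖ * ‖x‖ := by positivity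
  have h8 : 0 ≤ ζ * ‖L‖ := by positivity
  have h9 : 0 ≤ ‖B 0‖ * ‖x‖ := by positivity
  linarith

/-- A Lipschitz map grows at most affinely. -/
theorem IsLipBound.exists_norm_le {E F : Type*} [NormedAddCommGroup E] [NormedAddCommGroup F]
    {k : ℝ} {f : E → F} (hf : IsLipBound k f) :
    ∃ N, 0 ≤ N ∧ ∀ x, ‖f x‖ ≤ N * (‖x‖ + 1) := by
  refine ⟨|k| + ‖f 0‖, by positivity, fun x => ?_⟩
  have h1 := hf x 0
  rw [sub_zero] at h1
  have h2 := norm_le_norm_sub_add (f x) (f 0)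
  have h3 := mul_le_mul_of_nonneg_right (le_abs_self k) (norm_nonneg x)
  have h4 : 0 ≤ ‖f 0‖ * ‖x‖ := by positivity
  linarith [abs_nonneg k]

theorem statement18 {H G : Type*} [NormedAddCommGroup H] [InnerProductSpace ℝ H] [CompleteSpace H]
    [NormedAddCommGroup G] [InnerProductSpace ℝ G] [CompleteSpace G]
    (ρ β ζ α : ℝ) (A : H → Set H) (C : H → H) (B : G → G)
    (L : H →L[ℝ] G) (K : G →L[ℝ] H) (c : G)
    (hA : IsMaxMonotoneSV ρ A)
    (hβ : 0 < β) (hC : IsCocoercive β C)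
    (hζ : 0 < ζ) (hBmono : IsMonotoneMap B) (hBlip : IsLipBound ζ B)
    (hα : 0 ≤ α)
    (ζt : ℝ)
    (hζt : IsLipConst ζt (fun x : H => (ContinuousLinearMap.adjoint L - K) (B (L x))))
    (κ : ℝ) (hκ : IsLipConst κ (fun x : H => K (α • L x + B (L x))))
    (hρhat : 0 ≤ (ρ + α * lambdaMin L K - ζt))
    (hDK : ∃ x : H, Dop α L c B K x ≠ 0)
    (Kn : ℕ → G →L[ℝ] H) (ω : ℕ → ℝ) (hωnn : ∀ n, 0 ≤ ω n)
    (hωsum : Summable ω) (hKn : ∀ n, ‖Kn n - K‖ ≤ ω n)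
    (hsol : ∃ x : H, ((0:H) ∈ (fun u => u + C x + Dop α L c B K x) '' A x))
    (γ : ℝ) (hγ0 : 0 < γ)
    (hΓ₁ : κ ^ 2 * γ ^ 2 * (1 + γ / (2 * β)) < 1) (hΓ₂ : ρ * γ > -1)
    (J JC : H → H) (hJ : ∀ x y : H, J x = y ↔ x - y ∈ γ • A y)
    (hJC : ∀ x y : H, JC x = y ↔ x = y + γ • C y)
    (R V : H → H)
    (hRdef : ∀ z, R z = J ((2:ℝ) • JC z - z - γ • Dop α L c B K (JC z)))
    (hVdef : ∀ z, V z = R z - γ • Dop α L c B K (R z) + z -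
      (JC z - γ • Dop α L c B K (JC z)))
    (z x w y : ℕ → H)
    (hx : ∀ n, x n = JC (z n))
    (hw : ∀ n, w n = Dop α L c B (Kn n) (x n))
    (hy : ∀ n, y n = J ((2:ℝ) • x n - z n - γ • w n))
    (hzrec : ∀ n, z (n + 1) =
      z n + y n - x n - γ • (Dop α L c B (Kn n) (y n) - w n)) :
    ∃ zb : H, V zb = zb ∧
      (∀ v : H, Tendsto (fun n => ⟪z n, v⟫) atTop (𝓝 ⟪zb, v⟫)) ∧
      (∀ v : H, Tendsto (fun n => ⟪x n, v⟫) atTop (𝓝 ⟪JC zb, v⟫)) ∧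
      ((0:H) ∈ (fun u => u + C (JC zb) + Dop α L c B K (JC zb)) '' A (JC zb)) := by
  obtain ⟨x₁, hx₁⟩ := hDK
  have hκ0 : 0 ≤ κ := by
    have h1 := (norm_nonneg _).trans (hκ.1 (Dop α L c B K x₁) 0)
    exact nonneg_of_mul_nonneg_left h1 (norm_pos_iff.mpr (sub_ne_zero.mpr hx₁))
  set D := Dop α L c B K with hDdef
  have hD : IsLipBound κ D := dop_lipBound c hκ.1
  have hAD : ∀ x y u v, u ∈ A x → v ∈ A y →
      (0 : ℝ) ≤ ⟪x - y, (u + D x) - (v + D y)⟫ := by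
    intro a b u v hu hv
    have h1 := hA.1 a b u v hu hv
    have h2 := dop_inner_sub_le c hBmono hα hζt.1 a b
    rw [add_sub_add_comm, inner_add_right]
    have h3 := mul_nonneg hρhat (sq_nonneg ‖a - b‖)
    rw [← hDdef] at h2
    linarith
  have hsol' : ∃ x, -(C x + D x) ∈ A x := by
    obtain ⟨a, u, hu, hu0⟩ := hsol
    refine ⟨a, ?_⟩
    have hu0 : u + C a + D a = 0 := hu0
    rwa [← eq_neg_of_add_eq_zero_left ((add_assoc _ _ _).symm.trans hu0)]
  have hρ : 0 < 1 + ρ * γ := by linarith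
  have hJlip : IsLipBound (1 + ρ * γ)⁻¹ J := fun a b => by
    rw [inv_mul_eq_div, le_div_iff₀' hρ]
    exact resolvent_lipschitz hA.1 hγ0 hJ a b
  have hJClip : IsLipBound 1 JC := fun a b => by
    rw [one_mul]
    exact cocoercive_resolvent_nonexpansive hC hβ hγ0 hJC a b
  set j := (1 + ρ * γ)⁻¹
  have hj0 : 0 ≤ j := (inv_pos.mpr hρ).le
  have hRlip : IsLipBound (j * (3 + γ * κ)) R := fun a b => by
    rw [hRdef, hRdef, mul_assoc]
    refine (hJlip _ _).trans (mul_le_mul_of_nonneg_left ?_ hj0)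
    have e : (2 : ℝ) • JC a - a - γ • D (JC a) - ((2 : ℝ) • JC b - b - γ • D (JC b))
        = (2 : ℝ) • (JC a - JC b) - (a - b) - γ • (D (JC a) - D (JC b)) := by module
    have h1 := hJClip a b
    have h2 := (hD (JC a) (JC b)).trans (mul_le_mul_of_nonneg_left h1 hκ0)
    have h3 := mul_le_mul_of_nonneg_left h2 hγ0.le
    have h4 := norm_sub_le ((2 : ℝ) • (JC a - JC b) - (a - b)) (γ • (D (JC a) - D (JC b)))
    have h5 := norm_sub_le ((2 : ℝ) • (JC a - JC b)) (a - b)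
    rw [e]
    rw [norm_smul, Real.norm_eq_abs, abs_of_pos hγ0] at h4
    rw [norm_smul, Real.norm_eq_abs, abs_of_pos two_pos] at h5
    linarith
  obtain ⟨N, hN0, hN⟩ := exists_norm_dop_sub_dop_le α hζ.le hBlip L c
  obtain ⟨NC, hNC0, hNC⟩ := hJClip.exists_norm_le
  obtain ⟨NR, hNR0, hNR⟩ := hRlip.exists_norm_le
  set W := ∑' n, ω n
  have hωW : ∀ n, ω n ≤ W := fun n => hωsum.le_tsum n fun i _ => hωnn i
  have hW0 : 0 ≤ W := (hωnn 0).trans (hωW 0)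
  have hNK : ∀ n a, ‖Dop α L c B (Kn n) a - D a‖ ≤ ω n * (N * (‖a‖ + 1)) := fun n a =>
    (hN (Kn n) K a).trans (mul_le_mul_of_nonneg_right (hKn n) (by positivity))
  set Q := N * (NC + 1) with hQ
  have hQ0 : 0 ≤ Q := by positivity
  have hwerr : ∀ n, ‖w n - D (x n)‖ ≤ ω n * (Q * (‖z n‖ + 1)) := fun n => by
    rw [hw n, hx n]
    refine (hNK n _).trans (mul_le_mul_of_nonneg_left ?_ (hωnn n))
    rw [hQ, mul_assoc]
    refine mul_le_mul_of_nonneg_left ?_ hN0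
    linarith [hNC (z n), norm_nonneg (z n)]
  have hyerr : ∀ n, ‖y n - R (z n)‖ ≤ ω n * (j * γ * Q * (‖z n‖ + 1)) := fun n => by
    rw [hy n, hRdef, ← hx n]
    refine (hJlip _ _).trans ?_
    rw [sub_sub_sub_cancel_left, ← smul_sub, norm_smul, Real.norm_eq_abs, abs_of_pos hγ0,
      norm_sub_rev]
    have := mul_le_mul_of_nonneg_left (hwerr n) (mul_nonneg hj0 hγ0.le)
    linarith
  have hynorm : ∀ n, ‖y n‖ + 1 ≤ (NR + W * (j * γ * Q) + 1) * (‖z n‖ + 1) := fun n => by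
    have h1 := norm_le_norm_sub_add (y n) (R (z n))
    have h2 : ω n * (j * γ * Q * (‖z n‖ + 1)) ≤ W * (j * γ * Q * (‖z n‖ + 1)) :=
      mul_le_mul_of_nonneg_right (hωW n) (by positivity)
    linarith [hyerr n, hNR (z n), norm_nonneg (z n)]
  have hDyerr : ∀ n, ‖Dop α L c B (Kn n) (y n) - D (R (z n))‖ ≤
      ω n * ((N * (NR + W * (j * γ * Q) + 1) + κ * (j * γ * Q)) * (‖z n‖ + 1)) := fun n => by
    have h1 := norm_sub_le_norm_sub_add_norm_sub (Dop α L c B (Kn n) (y n)) (D (y n))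
      (D (R (z n)))
    have h2 := hNK n (y n)
    have h3 := mul_le_mul_of_nonneg_left (hynorm n) (mul_nonneg (hωnn n) hN0)
    have h4 := (hD (y n) (R (z n))).trans (mul_le_mul_of_nonneg_left (hyerr n) hκ0)
    linarith
  set T := N * (NR + W * (j * γ * Q) + 1) + κ * (j * γ * Q)
  have hT0 : 0 ≤ T := by positivity
  have herr : ∀ n, ‖z (n + 1) - V (z n)‖ ≤
      (j * γ * Q + γ * T + γ * Q) * ω n * (‖z n‖ + 1) := fun n => by
    have e : z (n + 1) - V (z n) = (y n - R (z n))
        - γ • (Dop α L c B (Kn n) (y n) - D (R (z n))) + γ • (w n - D (x n)) := by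
      rw [hzrec, hVdef, ← hx n]
      module
    have h1 := norm_add_le ((y n - R (z n))
        - γ • (Dop α L c B (Kn n) (y n) - D (R (z n)))) (γ • (w n - D (x n)))
    have h2 := norm_sub_le (y n - R (z n)) (γ • (Dop α L c B (Kn n) (y n) - D (R (z n))))
    rw [norm_smul, Real.norm_eq_abs, abs_of_pos hγ0] at h1 h2
    have h3 := mul_le_mul_of_nonneg_left (hwerr n) hγ0.le
    have h4 := mul_le_mul_of_nonneg_left (hDyerr n) hγ0.le
    rw [e]
    linarith [hyerr n]
  obtain ⟨s, hVs, hs, hzs, hxs⟩ := fbhf_weak_convergence hβ hC hγ0 hD hΓ₁ hAD hJ hJC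
    hRdef hVdef hsol' (by positivity) hωnn hωsum herr
  refine ⟨s, hVs, hzs, fun v => ?_, _, hs, ?_⟩
  · simp only [hx]
    exact hxs v
  · dsimp only
    abel
end
end
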